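/- Let λ be a regular uncountable cardinal, p a prime, and A an abelian group of cardinality λ that is λ-free. Let (A_α)_{α<λ} be a λ-filtration of A by pure subgroups with |A_α| ≤ |α| + ℵ₀ for each α, and let E ⊆ λ be a stationary subset such that the weak diamond Φ_λ(E) holds. Suppose that for every α ∈ E there is a group homomorphism from A_{α+1}/A_α to ℤ/pℤ that has no lifting to ℤ (i.e., Ext_p(A_{α+1}/A_α, ℤ) ≠ 0). Then Ext_p(A, ℤ) ≠ 0: there is a group homomorphism h : A → ℤ/pℤ that has no lifting to ℤ. -/

import Mathlib

/-- A subset `C` of the ordinals below `o` is club in `o` if it is unbounded in `o`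
and closed under suprema of bounded nonempty subsets. -/
def IsClubIn (C : Set Ordinal.{0}) (o : Ordinal.{0}) : Prop :=
  C ⊆ Set.Iio o ∧ (∀ α < o, ∃ β ∈ C, α ≤ β) ∧
  ∀ s : Set Ordinal.{0}, s ⊆ C → s.Nonempty → sSup s < o → sSup s ∈ C

/-- A subset `S` of the ordinals below `o` is stationary in `o` if it meets every club. -/
def IsStationaryIn (S : Set Ordinal.{0}) (o : Ordinal.{0}) : Prop :=
  ∀ C : Set Ordinal.{0}, IsClubIn C o → (S ∩ C).Nonempty

/-- The weak diamond `Φ_λ(E)`: for every colouring `F` of pairs `(α, f↾α)` (with `α < λ`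
and `f : λ → λ`) by `{0,1}`, there is `g : λ → 2` such that for every `f : λ → λ` the
set of `α ∈ E` where `F(α, f↾α) = g(α)` is stationary in `λ`. -/
def WeakDiamond (lam : Cardinal.{0}) (E : Set Ordinal.{0}) : Prop :=
  ∀ F : Ordinal.{0} → (Ordinal.{0} → Ordinal.{0}) → Bool,
    ∃ g : Ordinal.{0} → Bool,
      ∀ f : Ordinal.{0} → Ordinal.{0}, (∀ β, β < lam.ord → f β < lam.ord) →
        IsStationaryIn {α | α ∈ E ∧ F α (fun β => if β < α then f β else 0) = g α} lam.ord

open Order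

/-- A homomorphism to `ℤ/pℤ` extends along an injection of elementary abelian `p`-groups. -/
theorem AddMonoidHom.exists_comp_eq_of_injective {V W : Type*} [AddCommGroup V] [AddCommGroup W]
    {p : ℕ} (hp : p.Prime) (hV : ∀ x : V, p • x = 0) (hW : ∀ x : W, p • x = 0) (j : V →+ W)
    (hj : Function.Injective j) (ψ : V →+ ZMod p) : ∃ H : W →+ ZMod p, H.comp j = ψ := by
  have : Fact p.Prime := ⟨hp⟩
  let _ : Module (ZMod p) V := AddCommGroup.zmodModule hV
  let _ : Module (ZMod p) W := AddCommGroup.zmodModule hW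
  obtain ⟨r, hr⟩ := (j.toZModLinearMap p).exists_leftInverse_of_injective
    (LinearMap.ker_eq_bot.2 hj)
  refine ⟨ψ.comp r.toAddMonoidHom, AddMonoidHom.ext fun x => ?_⟩
  exact congrArg ψ (LinearMap.congr_fun hr x)

/-- A homomorphism to `ℤ/pℤ` extends from a `p`-pure subgroup. -/
theorem AddSubgroup.exists_extend_zmod {A : Type*} [AddCommGroup A] {p : ℕ} (hp : p.Prime)
    (S : AddSubgroup A) (hS : ∀ x : A, p • x ∈ S → ∃ c ∈ S, p • c = p • x)
    (ψ : S →+ ZMod p) : ∃ H : A →+ ZMod p, ∀ x : S, H x = ψ x := by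
  let P : AddSubgroup S := (nsmulAddMonoidHom (α := S) p).range
  let Q : AddSubgroup A := (nsmulAddMonoidHom (α := A) p).range
  have hPQ : P ≤ Q.comap S.subtype := by
    rintro _ ⟨y, rfl⟩
    exact ⟨y, by simp⟩
  have hψ : P ≤ ψ.ker := by
    rintro _ ⟨y, rfl⟩
    simp [AddMonoidHom.mem_ker]
  have hj : Function.Injective (QuotientAddGroup.map P Q S.subtype hPQ) := by
    rw [injective_iff_map_eq_zero]
    intro m hm
    induction m using QuotientAddGroup.induction_on with
    | H s =>
      obtain ⟨y, hy⟩ : (s : A) ∈ Q := (QuotientAddGroup.eq_zero_iff _).1 hm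
      have hy' : p • y = (s : A) := hy
      obtain ⟨c, hc, hcy⟩ := hS y (hy' ▸ s.2)
      refine (QuotientAddGroup.eq_zero_iff _).2 ⟨⟨c, hc⟩, Subtype.ext ?_⟩
      simpa using hcy.trans hy'
  have hP (x : S ⧸ P) : p • x = 0 := by
    induction x using QuotientAddGroup.induction_on with
    | H s => exact (QuotientAddGroup.eq_zero_iff (p • s)).2 ⟨s, rfl⟩
  have hQ (x : A ⧸ Q) : p • x = 0 := by
    induction x using QuotientAddGroup.induction_on with
    | H s => exact (QuotientAddGroup.eq_zero_iff (p • s)).2 ⟨s, rfl⟩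
  obtain ⟨H, hH⟩ := AddMonoidHom.exists_comp_eq_of_injective hp hP hQ _ hj
    (QuotientAddGroup.lift P ψ hψ)
  exact ⟨H.comp (QuotientAddGroup.mk' Q), fun x => DFunLike.congr_fun hH (QuotientAddGroup.mk x)⟩

/-- Coherent homomorphisms on a directed family of subgroups glue on the supremum. -/
theorem AddSubgroup.exists_hom_iSup {A B ι : Type*} [AddCommGroup A] [AddCommGroup B]
    [Nonempty ι] (K : ι → AddSubgroup A) (hK : Directed (· ≤ ·) K) (H : ι → A →+ B)
    (hH : ∀ i j, K i ≤ K j → ∀ x ∈ K i, H i x = H j x) :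
    ∃ ψ : (⨆ i, K i : AddSubgroup A) →+ B, ∀ i (x : (⨆ i, K i : AddSubgroup A)),
      (x : A) ∈ K i → ψ x = H i x := by
  have hmem (x : (⨆ i, K i : AddSubgroup A)) : ∃ i, (x : A) ∈ K i :=
    (AddSubgroup.mem_iSup_of_directed hK).1 x.2
  choose c hc using hmem
  have key (i) (x : (⨆ i, K i : AddSubgroup A)) (hx : (x : A) ∈ K i) :
      H (c x) x = H i x := by
    obtain ⟨j, h₁, h₂⟩ := hK (c x) i
    rw [hH _ j h₁ _ (hc x), hH _ j h₂ _ hx]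
  refine ⟨AddMonoidHom.mk' (fun x => H (c x) x) fun x y => ?_, fun i x hx => key i x hx⟩
  obtain ⟨j, h₁, h₂⟩ := hK (c x) (c y)
  have hx := h₁ (hc x)
  have hy := h₂ (hc y)
  rw [key j x hx, key j y hy, key j (x + y) (add_mem hx hy)]
  simp

/-- Let `S` be an increasing continuous chain of sets of size less than the regular uncountable
cardinal `λ`, and let `e` take values below `λ`. Then `{α < λ | ∀ a ∈ S α, e a < α}` is club. -/
theorem isClubIn_setOf_forall_lt {A : Type} {lam : Cardinal.{0}} (hreg : lam.IsRegular)
    (hunc : Cardinal.aleph0 < lam) (S : Ordinal.{0} → Set A) (hmono : Monotone S)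
    (hcont : ∀ δ < lam.ord, IsSuccLimit δ → ∀ a ∈ S δ, ∃ α < δ, a ∈ S α)
    (hcard : ∀ α < lam.ord, Cardinal.mk (S α) < lam)
    (e : A → Ordinal.{0}) (he : ∀ a, e a < lam.ord) :
    IsClubIn {α | α < lam.ord ∧ ∀ a ∈ S α, e a < α} lam.ord := by
  have hlim : IsSuccLimit lam.ord := Cardinal.isSuccLimit_ord hreg.aleph0_le
  refine ⟨fun α h => h.1, fun α hα => ?_, fun s hs hne hlt => ⟨hlt, ?_⟩⟩
  · let φ : Ordinal.{0} → Ordinal.{0} := fun β => max (succ β) (⨆ a : S β, succ (e a))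
    have hφ : ∀ β < lam.ord, φ β < lam.ord := fun β hβ =>
      max_lt (hlim.succ_lt hβ) (Ordinal.iSup_lt_of_lt_cof
        (by rw [hreg.cof_ord]; exact hcard β hβ) fun a => hlim.succ_lt (he a))
    have hδ : Ordinal.nfp φ α < lam.ord :=
      Ordinal.nfp_lt_ord (by rwa [hreg.cof_ord]) hφ hα
    have hstep : ∀ β < Ordinal.nfp φ α, ∃ n, β < φ^[n] α ∧ φ (φ^[n] α) ≤ Ordinal.nfp φ α := by
      intro β hβ
      obtain ⟨n, hn⟩ := Ordinal.lt_nfp_iff.1 hβ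
      refine ⟨n, hn, ?_⟩
      rw [← Function.iterate_succ_apply' φ]
      exact Ordinal.iterate_le_nfp φ α (n + 1)
    have hαδ : α < Ordinal.nfp φ α :=
      (lt_succ α).trans_le ((le_max_left _ _).trans (Ordinal.iterate_le_nfp φ α 1))
    have hδlim : IsSuccLimit (Ordinal.nfp φ α) := by
      refine ⟨fun h => (not_lt_of_ge (h hαδ.le)) hαδ, ?_⟩
      rw [isSuccPrelimit_iff_succ_lt]
      intro β hβ
      obtain ⟨n, hn, hle⟩ := hstep β hβ
      exact (succ_lt_succ hn).trans_le ((le_max_left _ _).trans hle)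
    refine ⟨_, ⟨hδ, fun a ha => ?_⟩, hαδ.le⟩
    obtain ⟨β, hβ, haβ⟩ := hcont _ hδ hδlim a ha
    obtain ⟨n, hn, hle⟩ := hstep β hβ
    have h₁ : succ (e a) ≤ ⨆ a : S (φ^[n] α), succ (e a) :=
      Ordinal.le_iSup (fun a : S (φ^[n] α) => succ (e a)) ⟨a, hmono hn.le haβ⟩
    exact (lt_succ _).trans_le (h₁.trans ((le_max_right _ _).trans hle))
  · have hbdd : BddAbove s := ⟨lam.ord, fun x hx => (hs hx).1.le⟩
    intro a ha
    by_cases hmem : sSup s ∈ s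
    · exact (hs hmem).2 a ha
    have hlt' : ∀ β < sSup s, ∃ γ ∈ s, β < γ := fun β hβ => exists_lt_of_lt_csSup hne hβ
    have hslim : IsSuccLimit (sSup s) := by
      obtain ⟨x, hx⟩ := hne
      have hxs : x < sSup s := lt_of_le_of_ne (le_csSup hbdd hx) fun h => hmem (h ▸ hx)
      refine ⟨fun h => (not_lt_of_ge (h hxs.le)) hxs, ?_⟩
      rw [isSuccPrelimit_iff_succ_lt]
      intro β hβ
      obtain ⟨γ, hγ, hβγ⟩ := hlt' β hβ
      exact lt_of_le_of_ne ((succ_le_of_lt hβγ).trans (le_csSup hbdd hγ))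
        fun h => hmem (h ▸ (le_antisymm (succ_le_of_lt hβγ) (h ▸ le_csSup hbdd hγ)) ▸ hγ)
    obtain ⟨β, hβ, haβ⟩ := hcont _ hlt hslim a ha
    obtain ⟨γ, hγ, hβγ⟩ := hlt' β hβ
    exact ((hs hγ).2 a (hmono hβγ.le haβ)).trans_le (le_csSup hbdd hγ)

/-- Along an increasing continuous chain of `p`-pure subgroups, a homomorphism to `ℤ/pℤ` can be
built by transfinite recursion, its values on `S (β + 1)` being prescribed as an extension
`ext β` of its restriction to `S β`. -/
theorem exists_hom_forall_succ_eq {A : Type*} [AddCommGroup A] {p : ℕ} (hp : p.Prime)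
    {o : Ordinal.{0}} (S : Ordinal.{0} → AddSubgroup A) (hmono : Monotone S)
    (hcont : ∀ δ < o, IsSuccLimit δ → ∀ a ∈ S δ, ∃ α < δ, a ∈ S α)
    (hpure : ∀ α < o, ∀ x : A, p • x ∈ S α → ∃ c ∈ S α, p • c = p • x)
    (ext : ∀ β, (S β →+ ZMod p) → A →+ ZMod p)
    (hext : ∀ β < o, ∀ ψ, ∀ x : S β, ext β ψ x = ψ x) :
    ∃ H : A →+ ZMod p, ∀ β < o, ∀ x ∈ S (β + 1), H x = ext β (H.comp (S β).subtype) x := by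
  let P : Ordinal.{0} → (A →+ ZMod p) → Prop := fun α H => (∀ x ∈ S 0, H x = 0) ∧
    ∀ β < α, ∀ x ∈ S (β + 1), H x = ext β (H.comp (S β).subtype) x
  have hPmono {α β H} (h : P β H) (hαβ : α ≤ β) : P α H :=
    ⟨h.1, fun γ hγ => h.2 γ (hγ.trans_le hαβ)⟩
  have huniq (α : Ordinal.{0}) : α < o → ∀ H H', P α H → P α H' → ∀ x ∈ S α, H x = H' x := by
    induction α using Ordinal.limitRecOn with
    | zero => exact fun _ H H' h h' x hx => (h.1 x hx).trans (h'.1 x hx).symm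
    | add_one α ih =>
      intro hα H H' h h' x hx
      have hlt : α < α + 1 := Order.lt_add_one_iff.2 le_rfl
      have heq : H.comp (S α).subtype = H'.comp (S α).subtype := by
        ext ⟨y, hy⟩
        exact ih (hlt.trans hα) H H' (hPmono h hlt.le) (hPmono h' hlt.le) y hy
      rw [h.2 α hlt x hx, h'.2 α hlt x hx, heq]
    | limit δ hδ ih =>
      intro hδo H H' h h' x hx
      obtain ⟨α, hα, hxα⟩ := hcont δ hδo hδ x hx
      exact ih α hα (hα.trans hδo) H H' (hPmono h hα.le) (hPmono h' hα.le) x hxα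
  have hex (α : Ordinal.{0}) : α ≤ o → ∃ H, P α H := by
    induction α using Ordinal.limitRecOn with
    | zero => exact fun _ => ⟨0, fun _ _ => rfl, fun β hβ => absurd hβ (not_lt_of_ge zero_le)⟩
    | add_one α ih =>
      intro hα
      have hlt : α < α + 1 := Order.lt_add_one_iff.2 le_rfl
      have hαo := hlt.trans_le hα
      obtain ⟨H, hH⟩ := ih hαo.le
      have hagree : ∀ x ∈ S α, ext α (H.comp (S α).subtype) x = H x :=
        fun x hx => hext α hαo _ ⟨x, hx⟩
      have hres : ∀ β ≤ α, (ext α (H.comp (S α).subtype)).comp (S β).subtype =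
          H.comp (S β).subtype := by
        intro β hβ
        ext ⟨y, hy⟩
        exact hagree y (hmono hβ hy)
      refine ⟨ext α (H.comp (S α).subtype), fun x hx => ?_, fun β hβ x hx => ?_⟩
      · rw [hagree x (hmono zero_le hx), hH.1 x hx]
      · rcases (Order.lt_add_one_iff.1 hβ).lt_or_eq with hβα | rfl
        · rw [hres β hβα.le, hagree x (hmono (Order.add_one_le_of_lt hβα) hx), hH.2 β hβα x hx]
        · rw [hres β le_rfl]
    | limit δ hδ ih =>
      intro hδo
      choose! H hH using fun α (hα : α < δ) => ih α hα (hα.le.trans hδo)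
      have : Nonempty (Set.Iio δ) := ⟨⟨0, hδ.bot_lt⟩⟩
      let K : Set.Iio δ → AddSubgroup A := fun α => S α
      have hKmono : Monotone K := fun α β h => hmono h
      have hK : Directed (· ≤ ·) K := hKmono.directed_le
      have hcoh' (i j : Set.Iio δ) (hij : i ≤ j) : ∀ x ∈ S i, H i x = H j x :=
        huniq i (i.2.trans_le hδo) _ _ (hH i i.2) (hPmono (hH j j.2) hij)
      have hcoh (i j : Set.Iio δ) (hij : K i ≤ K j) : ∀ x ∈ K i, H i x = H j x := by
        intro x hx
        rcases le_total i j with h | h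
        · exact hcoh' i j h x hx
        · exact (hcoh' j i h x (hij hx)).symm
      obtain ⟨ψ, hψ⟩ := AddSubgroup.exists_hom_iSup K hK (fun i => H i) hcoh
      obtain ⟨G, hG⟩ := AddSubgroup.exists_extend_zmod hp (⨆ i, K i) (fun x hx => by
        obtain ⟨i, hi⟩ := (AddSubgroup.mem_iSup_of_directed hK).1 hx
        obtain ⟨c, hc, hcx⟩ := hpure i (i.2.trans_le hδo) x hi
        exact ⟨c, AddSubgroup.mem_iSup_of_mem i hc, hcx⟩) ψ
      have hGH : ∀ α < δ, ∀ x ∈ S α, G x = H α x := fun α hα x hx => by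
        have hx' : x ∈ ⨆ i, K i := AddSubgroup.mem_iSup_of_mem (S := K) ⟨α, hα⟩ hx
        exact (hG ⟨x, hx'⟩).trans (hψ ⟨α, hα⟩ ⟨x, hx'⟩ hx)
      refine ⟨G, fun x hx => ?_, fun β hβ x hx => ?_⟩
      · rw [hGH 0 hδ.bot_lt x hx, (hH 0 hδ.bot_lt).1 x hx]
      · have hβ' : β + 1 < δ := hδ.add_one_lt hβ
        have hlt : β < β + 1 := Order.lt_add_one_iff.2 le_rfl
        have heq : G.comp (S β).subtype = (H (β + 1)).comp (S β).subtype := by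
          ext ⟨y, hy⟩
          exact hGH _ hβ' y (hmono hlt.le hy)
        rw [hGH _ hβ' x hx, heq, (hH _ hβ').2 β hlt x hx]
  obtain ⟨H, hH⟩ := hex o le_rfl
  exact ⟨H, hH.2⟩

/-- Theorem `nondivis` (weak diamond case): if `A` is a `λ`-free abelian group of regular
uncountable cardinality `λ` with a `λ`-filtration by pure subgroups, `E` is a stationary
subset of `λ` on which the weak diamond holds, and for every `α ∈ E` the quotient
`A_{α+1}/A_α` admits a homomorphism to `ℤ/pℤ` with no lifting to `ℤ`, then some
homomorphism `A → ℤ/pℤ` has no lifting to `ℤ` (i.e. `Ext_p(A, ℤ) ≠ 0`). -/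
theorem ext_p_ne_zero_of_weakDiamond (lam : Cardinal.{0}) (hreg : lam.IsRegular)
    (hunc : Cardinal.aleph0 < lam) (p : ℕ) (hp : p.Prime)
    (A : Type) [AddCommGroup A] (hcardA : Cardinal.mk A = lam)
    (hfree : ∀ S : AddSubgroup A, Cardinal.mk S < lam → Module.Free ℤ S)
    (Afil : Ordinal.{0} → AddSubgroup A)
    (hmono : ∀ α β : Ordinal.{0}, α ≤ β → Afil α ≤ Afil β)
    (hcont : ∀ δ : Ordinal.{0}, δ < lam.ord → Order.IsSuccLimit δ →
      Afil δ = ⨆ (α : Ordinal.{0}) (_ : α < δ), Afil α)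
    (hunion : (⨆ (α : Ordinal.{0}) (_ : α < lam.ord), Afil α) = ⊤)
    (hsize : ∀ α : Ordinal.{0}, α < lam.ord →
      Cardinal.mk (Afil α) ≤ α.card + Cardinal.aleph0)
    (hpureFil : ∀ α : Ordinal.{0}, α < lam.ord → ∀ n : ℕ, 1 ≤ n → ∀ b ∈ Afil α,
      (∃ x : A, n • x = b) → ∃ c ∈ Afil α, n • c = b)
    (E : Set Ordinal.{0}) (hE : E ⊆ Set.Iio lam.ord)
    (hstat : IsStationaryIn E lam.ord)
    (hwd : WeakDiamond lam E)
    (hext : ∀ α ∈ E,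
      ∃ k : (Afil (α + 1) ⧸ (Afil α).addSubgroupOf (Afil (α + 1))) →+ ZMod p,
        ¬ ∃ K : (Afil (α + 1) ⧸ (Afil α).addSubgroupOf (Afil (α + 1))) →+ ℤ,
          (Int.castAddHom (ZMod p)).comp K = k) :
    ∃ h : A →+ ZMod p, ¬ ∃ g : A →+ ℤ, (Int.castAddHom (ZMod p)).comp g = h := by
  classical
  have hlim : IsSuccLimit lam.ord := Cardinal.isSuccLimit_ord hreg.aleph0_le
  have hmono' : Monotone Afil := fun α β h => hmono α β h
  have hpure (α) (hα : α < lam.ord) (x : A) (hx : p • x ∈ Afil α) :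
      ∃ c ∈ Afil α, p • c = p • x := hpureFil α hα p hp.one_le _ hx ⟨x, rfl⟩
  have hcont' (δ) (hδ : δ < lam.ord) (hl : IsSuccLimit δ) (a) (ha : a ∈ Afil δ) :
      ∃ α < δ, a ∈ Afil α := by
    have : Nonempty (Set.Iio δ) := ⟨⟨0, hl.bot_lt⟩⟩
    have hdir : Directed (· ≤ ·) fun α : Set.Iio δ => Afil α :=
      Monotone.directed_le fun α β h => hmono α β h
    rw [hcont δ hδ hl, iSup_subtype'] at ha
    obtain ⟨α, hα⟩ := (AddSubgroup.mem_iSup_of_directed hdir).1 ha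
    exact ⟨α, α.2, hα⟩
  have hcard (α) (hα : α < lam.ord) : Cardinal.mk (Afil α) < lam :=
    (hsize α hα).trans_lt (Cardinal.add_lt_of_lt hreg.aleph0_le (Cardinal.lt_ord.1 hα) hunc)
  obtain ⟨e, he, heinj⟩ : ∃ e : A → Ordinal.{0}, (∀ a, e a < lam.ord) ∧ e.Injective := by
    have : Cardinal.lift.{1} (Cardinal.mk A) ≤
        Cardinal.lift.{0} (Cardinal.mk (Set.Iio lam.ord)) := by
      rw [Cardinal.mk_Iio_ordinal, Cardinal.card_ord, hcardA, Cardinal.lift_uzero]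
    obtain ⟨i⟩ := Cardinal.lift_mk_le'.1 this
    exact ⟨fun a => i a, fun a => (i a).2, fun a b h => i.injective (Subtype.ext h)⟩
  let enc : ℤ → Ordinal.{0} := fun n => (Encodable.encode n : ℕ)
  have henc : enc.Injective := fun a b h => Encodable.encode_injective (Nat.cast_injective h)
  have henc_lt (n : ℤ) : enc n < lam.ord :=
    (Ordinal.natCast_lt_omega0 _).trans_le (Cardinal.omega0_le_ord.2 hreg.aleph0_le)
  -- a chosen extension of each homomorphism `Afil α → ℤ/pℤ`
  have hX (α) (ψ : Afil α →+ ZMod p) :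
      ∃ H : A →+ ZMod p, α < lam.ord → ∀ x : Afil α, H x = ψ x := by
    by_cases hα : α < lam.ord
    · obtain ⟨H, hH⟩ := AddSubgroup.exists_extend_zmod hp (Afil α) (hpure α hα) ψ
      exact ⟨H, fun _ => hH⟩
    · exact ⟨0, fun h => absurd h hα⟩
  choose X hX using hX
  -- a homomorphism on `A` inducing a non-liftable one on the quotient
  have hk (α) : ∃ k : A →+ ZMod p, (α < lam.ord → ∀ x ∈ Afil α, k x = 0) ∧
      (α ∈ E → ∀ Φ : Afil (α + 1) →+ ℤ, (∀ x : Afil (α + 1), (x : A) ∈ Afil α → Φ x = 0) →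
        ¬ ∀ x, ((Φ x : ℤ) : ZMod p) = k x) := by
    by_cases hα : α ∈ E
    · obtain ⟨k, hk⟩ := hext α hα
      have hα' : α + 1 < lam.ord := hlim.add_one_lt (hE hα)
      have hle : α ≤ α + 1 := (Order.lt_add_one_iff.2 le_rfl).le
      obtain ⟨H, hH⟩ := AddSubgroup.exists_extend_zmod hp (Afil (α + 1)) (hpure _ hα')
        (k.comp (QuotientAddGroup.mk' _))
      refine ⟨H, fun _ x hx => ?_, fun _ Φ hΦ hΦk => hk ⟨QuotientAddGroup.lift _ Φ ?_, ?_⟩⟩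
      · have h₀ : (QuotientAddGroup.mk' ((Afil α).addSubgroupOf (Afil (α + 1))))
            ⟨x, hmono _ _ hle hx⟩ = 0 := (QuotientAddGroup.eq_zero_iff _).2 hx
        rw [hH ⟨x, hmono _ _ hle hx⟩, AddMonoidHom.comp_apply, h₀, map_zero]
      · exact fun x hx => hΦ x hx
      · ext x
        exact (hΦk x).trans (hH x)
    · exact ⟨0, fun _ _ _ => rfl, fun h => absurd h hα⟩
  choose k hk₀ hk using hk
  obtain ⟨g, hg⟩ := hwd fun α f => decide (∃ Φ : Afil (α + 1) →+ ℤ,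
    (∀ x : Afil (α + 1), (x : A) ∈ Afil α → f (e x) = enc (Φ x)) ∧
    ∃ ψ : Afil α →+ ZMod p, (∀ (x : Afil (α + 1)) (hx : (x : A) ∈ Afil α),
      ψ ⟨x, hx⟩ = (Φ x : ZMod p)) ∧ ∀ x, (Φ x : ZMod p) = X α ψ x)
  obtain ⟨h, hh⟩ := exists_hom_forall_succ_eq hp Afil hmono' hcont' hpure
    (fun α ψ => X α ψ + if g α then k α else 0) (fun α hα ψ x => by
      cases g α <;> simp [hX α ψ hα x, hk₀ α hα x x.2])
  refine ⟨h, ?_⟩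
  rintro ⟨φ, hφ⟩
  have hφ' (x : A) : (φ x : ZMod p) = h x := DFunLike.congr_fun hφ x
  obtain ⟨α, ⟨hαE, hα⟩, hαlt, hαC⟩ := hg (fun β => enc (φ (Function.invFun e β)))
    (fun _ _ => henc_lt _) _ (isClubIn_setOf_forall_lt hreg hunc (fun α => (Afil α : Set A))
      (fun α β h => hmono α β h) hcont' hcard e he)
  have hfe (x : A) (hx : x ∈ Afil α) :
      (if e x < α then enc (φ (Function.invFun e (e x))) else 0) = enc (φ x) := by
    rw [if_pos (hαC x hx), Function.leftInverse_invFun heinj x]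
  have hle : α ≤ α + 1 := (Order.lt_add_one_iff.2 le_rfl).le
  cases hgα : g α with
  | false =>
    rw [hgα, decide_eq_false_iff_not] at hα
    refine hα ⟨φ.comp (Afil (α + 1)).subtype, fun x hx => hfe x hx,
      h.comp (Afil α).subtype, fun x hx => (hφ' x).symm, fun x => (hφ' x).trans ?_⟩
    simpa [hgα] using hh α hαlt x x.2
  | true =>
    rw [hgα, decide_eq_true_iff] at hα
    obtain ⟨Φ, hΦ, ψ, hψ, hΦX⟩ := hα
    have hΦφ (x : Afil (α + 1)) (hx : (x : A) ∈ Afil α) : Φ x = φ x :=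
      henc ((hΦ x hx).symm.trans (hfe x hx))
    have hψh : ψ = h.comp (Afil α).subtype := by
      ext ⟨y, hy⟩
      rw [hψ ⟨y, hmono _ _ hle hy⟩ hy, hΦφ _ hy]
      exact hφ' y
    refine hk α hαE (φ.comp (Afil (α + 1)).subtype - Φ) (fun x hx => ?_) fun x => ?_
    · simp [hΦφ x hx]
    · have := hh α hαlt x x.2
      simp only [hgα, if_true, AddMonoidHom.add_apply] at this
      simp [hφ', hΦX, hψh, this]
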